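/- Refined tail bound excluding the one-symbol strings: the sum over all nonempty binary strings s different from "0" and "1" of (m(s) − m_5(s)) is at most Σ_{n=6}^∞ [2(4n+2)^(2n) − 12(4n+2)^(2n−1) − 8(n−1)(4n)^(2n−1)] / 2^(n+1+⌈log₂((4n+2)^(2n))⌉), obtained by discounting, for each n ≥ 6 and each blank symbol, the (4n+2)^(2n−1) computations that output "0", the (4n+2)^(2n−1) computations that output "1", the 4(4n+2)^(2n−1) non-halting computations whose initial transition stays in the initial state, and the 4(n−1)(4n)^(2n−1) non-halting computations with no transition to the halting state whose initial transition leaves the initial state. -/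

import Mathlib

/-- An instruction of a Busy Beaver machine: `Sum.inl b` means "write `b` and move to the
halting state (no head movement)"; `Sum.inr (q, b, d)` means "write `b`, move the head in
direction `d` (`true` = right, `false` = left) and change to state `q`".  For the class
`(n,2)` there are `4 * n + 2` instructions. -/
abbrev Instr (n : ℕ) := Bool ⊕ (Fin n × Bool × Bool)

/-- A Turing machine in the class `(n,2)`: a transition table assigning an instruction to
every pair (current state, read symbol). -/
abbrev Machine (n : ℕ) := (Fin n × Bool) → Instr n

/-- A configuration: current state (`none` = halted), tape contents, head position, and the
interval `[lo, hi]` of cells visited so far by the head. -/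
structure Config (n : ℕ) where
  state : Option (Fin n)
  tape : ℤ → Bool
  pos : ℤ
  lo : ℤ
  hi : ℤ

/-- One computation step. -/
def step {n : ℕ} (M : Machine n) (c : Config n) : Config n :=
  match c.state with
  | none => c
  | some q =>
    match M (q, c.tape c.pos) with
    | Sum.inl b => { c with state := none, tape := Function.update c.tape c.pos b }
    | Sum.inr (q', b, d) =>
      let p := c.pos + (if d then 1 else -1)
      { state := some q', tape := Function.update c.tape c.pos b,
        pos := p, lo := min c.lo p, hi := max c.hi p }

/-- The initial configuration on a tape uniformly filled with the blank symbol `i`,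
started in the initial state (state `⟨0, _⟩`, i.e. state "1" of `{1,…,n}`). -/
def initConfig (n : ℕ) (i : Bool) : Config n :=
  { state := if h : 0 < n then some ⟨0, h⟩ else none,
    tape := fun _ => i, pos := 0, lo := 0, hi := 0 }

/-- The configuration after `t` steps of the run `τ(i)`. -/
def cfgAt {n : ℕ} (M : Machine n) (i : Bool) (t : ℕ) : Config n :=
  (step M)^[t] (initConfig n i)

/-- A configuration is halted when the machine has entered the halting state. -/
def Halted {n : ℕ} (c : Config n) : Prop := c.state = none

/-- The output read off a configuration: the symbols in the cells visited by the head. -/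
def outputOf {n : ℕ} (c : Config n) : List Bool :=
  (List.range (c.hi - c.lo + 1).toNat).map fun j => c.tape (c.lo + j)

/-- `Outputs M i s` : the run `τ(i)` of `M` on blank symbol `i` halts with output `s`. -/
def Outputs {n : ℕ} (M : Machine n) (i : Bool) (s : List Bool) : Prop :=
  ∃ t, Halted (cfgAt M i t) ∧ outputOf (cfgAt M i t) = s

/-- `|{τ ∈ (n,2) : τ(i) = s}|`. -/
noncomputable def numOutput (n : ℕ) (i : Bool) (s : List Bool) : ℕ :=
  Nat.card {τ : Machine n // Outputs τ i s}

/-- The exponent `n + 1 + ⌈log₂((4n+2)^(2n))⌉` (the length of the program encodings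
with `n` states). -/
def expo (n : ℕ) : ℕ := n + 1 + Nat.clog 2 ((4 * n + 2) ^ (2 * n))

/-- The `n`-th term of the series defining `m(s)`. -/
noncomputable def mTerm (n : ℕ) (s : List Bool) : ℝ :=
  ((numOutput n false s + numOutput n true s : ℕ) : ℝ) / 2 ^ expo n

/-- The measure `m(s) = Σ_{n=1}^∞ (|{τ ∈ (n,2) : τ(0)=s}| + |{τ ∈ (n,2) : τ(1)=s}|) /
2^(n+1+⌈log₂((4n+2)^(2n))⌉)`. -/
noncomputable def mDist (s : List Bool) : ℝ := ∑' j : ℕ, mTerm (j + 1) s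

/-- The finite approximation `m_k(s)`: the same sum truncated to `1 ≤ n ≤ k`. -/
noncomputable def mApprox (k : ℕ) (s : List Bool) : ℝ :=
  ∑ n ∈ Finset.Icc 1 k, mTerm n s

/-- The finite approximation `m_k(s)` as a rational number. -/
noncomputable def mApproxQ (k : ℕ) (s : List Bool) : ℚ :=
  ∑ n ∈ Finset.Icc 1 k,
    ((numOutput n false s + numOutput n true s : ℕ) : ℚ) / 2 ^ expo n

/-- The initial pair (state, read symbol) of a run on blank symbol `i`. -/
abbrev startPair (m : ℕ) (i : Bool) : Fin (m + 1) × Bool := (0, i)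

theorem initConfig_state (m : ℕ) (i : Bool) : (initConfig (m + 1) i).state = some 0 := by
  simp [initConfig]

theorem cfgAt_succ {n : ℕ} (M : Machine n) (i : Bool) (t : ℕ) :
    cfgAt M i (t + 1) = step M (cfgAt M i t) :=
  Function.iterate_succ_apply' ..

theorem step_of_halted {n : ℕ} (M : Machine n) {c : Config n} (h : Halted c) :
    step M c = c := by
  unfold Halted at h
  simp [step, h]

theorem cfgAt_add_of_halted {n : ℕ} {M : Machine n} {i : Bool} {t : ℕ}
    (h : Halted (cfgAt M i t)) (k : ℕ) : cfgAt M i (t + k) = cfgAt M i t := by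
  induction k with
  | zero => rfl
  | succ k ih => rw [← add_assoc, cfgAt_succ, ih, step_of_halted M h]

theorem Outputs.unique {n : ℕ} {M : Machine n} {i : Bool} {s s' : List Bool}
    (h : Outputs M i s) (h' : Outputs M i s') : s = s' := by
  obtain ⟨t, ht, rfl⟩ := h
  obtain ⟨t', ht', rfl⟩ := h'
  rw [← cfgAt_add_of_halted ht t', ← cfgAt_add_of_halted ht' t, add_comm]

theorem outputs_singleton_of_start_halts {m : ℕ} {M : Machine (m + 1)} {i b : Bool}
    (h : M (startPair m i) = Sum.inl b) : Outputs M i [b] := by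
  have hi : (initConfig (m + 1) i) = ⟨some 0, fun _ => i, 0, 0, 0⟩ := by simp [initConfig]
  refine ⟨1, ?_, ?_⟩ <;>
    simp [cfgAt, hi, step, h, Halted, outputOf, List.range_succ]

theorem not_halted_of_start_stays {m : ℕ} {M : Machine (m + 1)} {i b d : Bool}
    (h : M (startPair m i) = Sum.inr (0, b, d)) (t : ℕ) : ¬ Halted (cfgAt M i t) := by
  suffices H : (cfgAt M i t).state = some 0 ∧
      ∀ k : ℕ, (cfgAt M i t).tape ((cfgAt M i t).pos + k * (if d then 1 else -1)) = i by
    simp [Halted, H.1]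
  induction t with
  | zero => exact ⟨initConfig_state m i, fun _ => rfl⟩
  | succ t ih =>
    obtain ⟨hs, ht⟩ := ih
    have h0 : (cfgAt M i t).tape (cfgAt M i t).pos = i := by simpa using ht 0
    rw [cfgAt_succ]
    generalize cfgAt M i t = c at *
    have hstep : M (0, c.tape c.pos) = Sum.inr (0, b, d) := by rw [h0]; exact h
    simp only [step, hs, hstep, true_and]
    intro k
    rw [Function.update_of_ne (by split_ifs <;> omega), ← ht (k + 1)]
    congr 1
    push_cast
    ring

theorem not_halted_of_no_halting_instruction {m : ℕ} {M : Machine (m + 1)}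
    (h : ∀ x, (M x).isRight) (i : Bool) (t : ℕ) : ¬ Halted (cfgAt M i t) := by
  suffices H : (cfgAt M i t).state.isSome by
    intro hh
    unfold Halted at hh
    simp [hh] at H
  induction t with
  | zero => simp [cfgAt, initConfig_state]
  | succ t ih =>
    rw [cfgAt_succ]
    generalize cfgAt M i t = c at *
    obtain ⟨q, hq⟩ := Option.isSome_iff_exists.1 ih
    obtain ⟨y, hy⟩ := Sum.isRight_iff.1 (h (q, c.tape c.pos))
    simp [step, hq, hy]

theorem card_piFinset_update_const {α β : Type*} [Fintype α] [DecidableEq α] (a : α)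
    (S T : Finset β) :
    (Fintype.piFinset (Function.update (fun _ : α => S) a T)).card =
      T.card * S.card ^ (Fintype.card α - 1) := by
  have hcard (x : α) : (Function.update (fun _ : α => S) a T x).card =
      Function.update (fun _ : α => S.card) a T.card x := by
    by_cases hx : x = a
    · subst hx; simp
    · simp [hx]
  rw [Fintype.card_piFinset, Finset.prod_congr rfl fun x _ => hcard x,
    Finset.prod_update_of_mem (Finset.mem_univ a), Finset.prod_const,
    Finset.card_sdiff_of_subset (Finset.subset_univ _), Finset.card_univ, Finset.card_singleton]

/-- Instructions that halt or stay in the initial state. -/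
def haltOrStay (m : ℕ) : Finset (Instr (m + 1)) :=
  Finset.univ.disjSum ({0} ×ˢ Finset.univ)

/-- Instructions that leave for a non-halting state other than the initial one. -/
def leaveStart (m : ℕ) : Finset (Instr (m + 1)) :=
  (∅ : Finset Bool).disjSum ({0}ᶜ ×ˢ Finset.univ)

/-- Instructions that do not halt. -/
def nonHalting (m : ℕ) : Finset (Instr (m + 1)) :=
  (∅ : Finset Bool).disjSum Finset.univ

/-- Machines whose first transition on blank symbol `i` halts or stays in the initial state. -/
def haltOrStayMachines (m : ℕ) (i : Bool) : Finset (Machine (m + 1)) :=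
  Fintype.piFinset (Function.update (fun _ => Finset.univ) (startPair m i) (haltOrStay m))

/-- Machines without halting transitions whose first transition on blank symbol `i` leaves
the initial state. -/
def neverHaltMachines (m : ℕ) (i : Bool) : Finset (Machine (m + 1)) :=
  Fintype.piFinset (Function.update (fun _ => nonHalting m) (startPair m i) (leaveStart m))

theorem card_instr (n : ℕ) : Fintype.card (Instr n) = 4 * n + 2 := by
  simp only [Fintype.card_sum, Fintype.card_prod, Fintype.card_bool, Fintype.card_fin]
  ring

theorem card_machine (n : ℕ) : Fintype.card (Machine n) = (4 * n + 2) ^ (2 * n) := by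
  rw [Fintype.card_fun, card_instr, Fintype.card_prod, Fintype.card_bool, Fintype.card_fin,
    mul_comm n]

theorem card_haltOrStayMachines (m : ℕ) (i : Bool) :
    (haltOrStayMachines m i).card = 6 * (4 * (m + 1) + 2) ^ (2 * (m + 1) - 1) := by
  rw [haltOrStayMachines, card_piFinset_update_const, Finset.card_univ, card_instr]
  simp [haltOrStay, mul_comm]

theorem card_neverHaltMachines (m : ℕ) (i : Bool) :
    (neverHaltMachines m i).card = 4 * m * (4 * (m + 1)) ^ (2 * (m + 1) - 1) := by
  rw [neverHaltMachines, card_piFinset_update_const]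
  simp [leaveStart, nonHalting, Finset.card_compl, mul_comm]

theorem disjoint_haltOrStay_neverHalt (m : ℕ) (i : Bool) :
    Disjoint (haltOrStayMachines m i) (neverHaltMachines m i) := by
  rw [Finset.disjoint_left]
  intro M h h'
  have h1 : M (startPair m i) ∈ haltOrStay m := by
    simpa using Fintype.mem_piFinset.1 h (startPair m i)
  have h2 : M (startPair m i) ∈ leaveStart m := by
    simpa using Fintype.mem_piFinset.1 h' (startPair m i)
  rcases hM : M (startPair m i) with b | ⟨q, b, d⟩ <;>
    simp_all [haltOrStay, leaveStart]

/-- Nonempty strings other than the one-symbol strings. -/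
abbrev LongString := {s : List Bool // s ≠ [] ∧ s ≠ [false] ∧ s ≠ [true]}

theorem not_outputs_of_mem_haltOrStayMachines {m : ℕ} {i : Bool} {M : Machine (m + 1)}
    (hM : M ∈ haltOrStayMachines m i) (s : LongString) : ¬ Outputs M i s.val := by
  intro hs
  have h : M (startPair m i) ∈ haltOrStay m := by
    simpa using Fintype.mem_piFinset.1 hM (startPair m i)
  rcases hx : M (startPair m i) with b | ⟨q, b, d⟩
  · have := hs.unique (outputs_singleton_of_start_halts hx)
    cases b
    · exact s.2.2.1 this
    · exact s.2.2.2 this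
  · obtain rfl : q = 0 := by simpa [hx, haltOrStay, eq_comm] using h
    obtain ⟨t, ht, -⟩ := hs
    exact not_halted_of_start_stays hx t ht

theorem not_outputs_of_mem_neverHaltMachines {m : ℕ} {i : Bool} {M : Machine (m + 1)}
    (hM : M ∈ neverHaltMachines m i) (s : List Bool) : ¬ Outputs M i s := by
  rintro ⟨t, ht, -⟩
  refine not_halted_of_no_halting_instruction (fun x => ?_) i t ht
  have h := Fintype.mem_piFinset.1 hM x
  by_cases hx : x = startPair m i
  · subst hx
    rcases hy : M (startPair m i) with b | y
    · simp [hy, leaveStart] at h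
    · rfl
  · rw [Function.update_of_ne hx] at h
    rcases hy : M x with b | y
    · simp [hy, nonHalting] at h
    · rfl

theorem sum_numOutput_add_le (m : ℕ) (i : Bool) (F : Finset LongString) :
    ∑ s ∈ F, numOutput (m + 1) i s.val + 6 * (4 * (m + 1) + 2) ^ (2 * (m + 1) - 1) +
      4 * m * (4 * (m + 1)) ^ (2 * (m + 1) - 1) ≤ (4 * (m + 1) + 2) ^ (2 * (m + 1)) := by
  classical
  set P : LongString → Finset (Machine (m + 1)) :=
    fun s => Finset.univ.filter fun M => Outputs M i s.val
  have hP (s : LongString) : numOutput (m + 1) i s.val = (P s).card := by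
    rw [numOutput, Nat.card_eq_fintype_card, Fintype.card_subtype]
  have hdisj : (F : Set LongString).PairwiseDisjoint P := by
    intro s _ s' _ hne
    refine Finset.disjoint_left.2 fun M hs hs' => hne (Subtype.ext ?_)
    exact (Finset.mem_filter.1 hs).2.unique (Finset.mem_filter.1 hs').2
  have h1 : Disjoint (F.biUnion P) (haltOrStayMachines m i) := by
    refine Finset.disjoint_left.2 fun M hM hM' => ?_
    obtain ⟨s, -, hs⟩ := Finset.mem_biUnion.1 hM
    exact not_outputs_of_mem_haltOrStayMachines hM' s (Finset.mem_filter.1 hs).2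
  have h2 : Disjoint (F.biUnion P) (neverHaltMachines m i) := by
    refine Finset.disjoint_left.2 fun M hM hM' => ?_
    obtain ⟨s, -, hs⟩ := Finset.mem_biUnion.1 hM
    exact not_outputs_of_mem_neverHaltMachines hM' s (Finset.mem_filter.1 hs).2
  rw [Finset.sum_congr rfl fun s _ => hP s, ← Finset.card_biUnion hdisj,
    ← card_haltOrStayMachines m i, ← card_neverHaltMachines m i, ← card_machine,
    ← Finset.card_union_of_disjoint h1, ← Finset.card_union_of_disjoint
      (Finset.disjoint_union_left.2 ⟨h2, disjoint_haltOrStay_neverHalt m i⟩)]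
  exact Finset.card_le_univ _

theorem mTerm_nonneg (n : ℕ) (s : List Bool) : 0 ≤ mTerm n s := by
  unfold mTerm
  positivity

theorem two_mul_pow_div_le (n : ℕ) :
    2 * (4 * n + 2 : ℝ) ^ (2 * n) / 2 ^ expo n ≤ (1 / 2) ^ n := by
  have h : (4 * n + 2 : ℝ) ^ (2 * n) ≤ 2 ^ Nat.clog 2 ((4 * n + 2) ^ (2 * n)) := by
    exact_mod_cast Nat.le_pow_clog one_lt_two _
  rw [expo, one_div, inv_pow, div_le_iff₀ (by positivity), pow_add, pow_succ]
  calc 2 * (4 * n + 2 : ℝ) ^ (2 * n)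
      ≤ 2 * 2 ^ Nat.clog 2 ((4 * n + 2) ^ (2 * n)) := by gcongr
    _ = _ := by field_simp

theorem numOutput_le (n : ℕ) (i : Bool) (s : List Bool) :
    numOutput n i s ≤ (4 * n + 2) ^ (2 * n) := by
  rw [numOutput, ← card_machine, ← Nat.card_eq_fintype_card]
  exact Finite.card_subtype_le _

theorem mTerm_le (n : ℕ) (s : List Bool) : mTerm n s ≤ (1 / 2) ^ n := by
  refine le_trans ?_ (two_mul_pow_div_le n)
  unfold mTerm
  gcongr
  have := numOutput_le n false s
  have := numOutput_le n true s
  have h : numOutput n false s + numOutput n true s ≤ 2 * (4 * n + 2) ^ (2 * n) := by omega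
  exact_mod_cast h

theorem summable_mTerm (s : List Bool) : Summable fun n => mTerm n s :=
  Summable.of_nonneg_of_le (fun n => mTerm_nonneg n s) (fun n => mTerm_le n s)
    summable_geometric_two

theorem mDist_sub_mApprox (k : ℕ) (s : List Bool) :
    mDist s - mApprox k s = ∑' j : ℕ, mTerm (j + (k + 1)) s := by
  have h := ((summable_nat_add_iff 1).2 (summable_mTerm s)).sum_add_tsum_nat_add k
  have hk : mApprox k s = ∑ j ∈ Finset.range k, mTerm (j + 1) s := by
    rw [mApprox, Finset.range_eq_Ico, Finset.sum_Ico_add' (fun n => mTerm n s)]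
    rfl
  rw [mDist, hk, ← h, add_sub_cancel_left]
  rfl

/-- The number of computations on both blank symbols, by `n`-state machines, that remain after
discounting those known not to output a string of length at least two. -/
noncomputable def remaining (n : ℕ) : ℝ :=
  2 * (4 * n + 2 : ℝ) ^ (2 * n) - 12 * (4 * n + 2 : ℝ) ^ (2 * n - 1) -
    8 * ((n : ℝ) - 1) * (4 * n : ℝ) ^ (2 * n - 1)

theorem sum_mTerm_le (m : ℕ) (F : Finset LongString) :
    ∑ s ∈ F, mTerm (m + 1) s.val ≤ remaining (m + 1) / 2 ^ expo (m + 1) := by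
  have h (i : Bool) : ((∑ s ∈ F, numOutput (m + 1) i s.val +
      6 * (4 * (m + 1) + 2) ^ (2 * (m + 1) - 1) +
      4 * m * (4 * (m + 1)) ^ (2 * (m + 1) - 1) : ℕ) : ℝ) ≤
        ((4 * (m + 1) + 2) ^ (2 * (m + 1)) : ℕ) := by
    exact_mod_cast sum_numOutput_add_le m i F
  have h0 := h false
  have h1 := h true
  unfold mTerm remaining
  rw [← Finset.sum_div]
  gcongr
  push_cast at h0 h1 ⊢
  rw [Finset.sum_add_distrib]
  linarith

theorem summable_remaining :
    Summable fun n : ℕ => remaining n / 2 ^ expo n := by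
  rw [← summable_nat_add_iff 1]
  refine Summable.of_nonneg_of_le (fun m => by simpa using sum_mTerm_le m ∅) (fun m => ?_)
    ((summable_nat_add_iff 1).2 summable_geometric_two)
  refine le_trans ?_ (two_mul_pow_div_le (m + 1))
  unfold remaining
  gcongr
  have h1 : (0 : ℝ) ≤ 12 * (4 * (m + 1 : ℕ) + 2 : ℝ) ^ (2 * (m + 1) - 1) := by positivity
  have h2 : (0 : ℝ) ≤ 8 * (((m + 1 : ℕ) : ℝ) - 1) *
      (4 * (m + 1 : ℕ) : ℝ) ^ (2 * (m + 1) - 1) := by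
    rw [Nat.cast_succ, add_sub_cancel_right]
    positivity
  linarith

/-- Refined tail bound excluding the one-symbol strings: the total error of `m_5` over all
nonempty strings different from "0" and "1" is at most
`Σ_{n=6}^∞ [2(4n+2)^(2n) - 12(4n+2)^(2n-1) - 8(n-1)(4n)^(2n-1)] / 2^(n+1+⌈log₂((4n+2)^(2n))⌉)`. -/
theorem refined_tail_bound :
    ∑' s : {s : List Bool // s ≠ [] ∧ s ≠ [false] ∧ s ≠ [true]},
        (mDist s.val - mApprox 5 s.val) ≤
      ∑' j : ℕ,
        (2 * ((4 * (j + 6) + 2 : ℝ)) ^ (2 * (j + 6)) -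
            12 * ((4 * (j + 6) + 2 : ℝ)) ^ (2 * (j + 6) - 1) -
            8 * ((j + 6 : ℝ) - 1) * ((4 * (j + 6) : ℝ)) ^ (2 * (j + 6) - 1)) /
          2 ^ expo (j + 6) := by
  have hR : Summable fun j : ℕ => remaining (j + 6) / 2 ^ expo (j + 6) :=
    summable_remaining.comp_injective (add_left_injective 6)
  have key (F : Finset LongString) : ∑ s ∈ F, (mDist s.val - mApprox 5 s.val) ≤
      ∑' j : ℕ, remaining (j + 6) / 2 ^ expo (j + 6) := by
    have hs (s : LongString) : Summable fun j : ℕ => mTerm (j + 6) s.val :=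
      (summable_mTerm s.val).comp_injective (add_left_injective 6)
    rw [Finset.sum_congr rfl fun s _ => mDist_sub_mApprox 5 s.val,
      ← Summable.tsum_finsetSum fun s _ => hs s]
    exact (summable_sum fun s _ => hs s).tsum_le_tsum (fun j => sum_mTerm_le (j + 5) F) hR
  have hcast (j : ℕ) : ((j + 6 : ℕ) : ℝ) = j + 6 := by push_cast; rfl
  simp only [remaining, hcast] at key
  exact tsum_le_of_sum_le' (by simpa using key ∅) key
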